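/- Let s, s' ∈ 𝒟_C with Δ(s,s') = Γ(C) and S := { x ∈ 𝒳_C : Δ(s,x) < Γ(C) }. In the homogeneous case (activation rate ν, transmission rate 1), the stationary probability flow out of S satisfies the exact identity Q(S,S^c) := Σ_{x ∈ S, y ∈ S^c} π_C(x) q(x,y) = Z^{-1} ν^{𝒜(C) − Γ(C) + 1} B(S), where B(S) := #{ (x,y) ∈ S × S^c : y is one CSMA step from x } is independent of ν. -/

import Mathlib

open scoped Classical

noncomputable section

namespace CSMA

/-- An activity state of a multi-channel CSMA network with `N` nodes and `C` channels:
node `i` is inactive if `x i = 0` and active on channel `c` if `x i = c` (`1 ≤ c ≤ C`). -/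
abbrev CState (N C : ℕ) := Fin N → Fin (C + 1)

/-- Feasibility of an activity state: for every channel `c` and every edge of the conflict
graph `E c`, the two endpoints are not both active on channel `c`. -/
def Feasible {N C : ℕ} (E : Fin C → SimpleGraph (Fin N)) (x : CState N C) : Prop :=
  ∀ c : Fin C, ∀ i j : Fin N, (E c).Adj i j → ¬(x i = c.succ ∧ x j = c.succ)

/-- `a(x)`: the number of active nodes in state `x`. -/
def activeCount {N C : ℕ} (x : CState N C) : ℕ :=
  (Finset.univ.filter fun i => x i ≠ 0).card

/-- The finite set `𝒳_C` of feasible activity states. -/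
def FeasibleSet {N C : ℕ} (E : Fin C → SimpleGraph (Fin N)) : Finset (CState N C) :=
  Finset.univ.filter fun x => Feasible E x

/-- `𝒜(C)`: the maximum number of simultaneously active nodes over feasible states. -/
def maxActive {N C : ℕ} (E : Fin C → SimpleGraph (Fin N)) : ℕ :=
  (FeasibleSet E).sup activeCount

/-- `𝒟_C`: the set of dominant states, i.e. feasible states with `𝒜(C)` active nodes. -/
def DominantSet {N C : ℕ} (E : Fin C → SimpleGraph (Fin N)) : Finset (CState N C) :=
  (FeasibleSet E).filter fun x => activeCount x = maxActive E

/-- A single CSMA step: both states are feasible and `y` is obtained from `x` by either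
the activation of a single inactive node on some channel, or the deactivation of a single
active node (a node cannot change channel in a single step). -/
def Step {N C : ℕ} (E : Fin C → SimpleGraph (Fin N)) (x y : CState N C) : Prop :=
  Feasible E x ∧ Feasible E y ∧
    ∃ i : Fin N, (∀ j : Fin N, j ≠ i → y j = x j) ∧
      ((x i = 0 ∧ y i ≠ 0) ∨ (x i ≠ 0 ∧ y i = 0))

/-- `ω` is a path of CSMA steps from `x` to `y` inside the feasible state space. -/
def IsPath {N C : ℕ} (E : Fin C → SimpleGraph (Fin N)) (x y : CState N C)
    (ω : List (CState N C)) : Prop :=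
  ω.head? = some x ∧ ω.getLast? = some y ∧ (∀ z ∈ ω, Feasible E z) ∧ ω.Chain' (Step E)

/-- The height of a path: `max_{z ∈ ω} (𝒜(C) − a(z))`. -/
def pathHeight {N C : ℕ} (E : Fin C → SimpleGraph (Fin N)) (ω : List (CState N C)) : ℕ :=
  (ω.map fun z => maxActive E - activeCount z).foldr max 0

/-- The communication height `Δ(x,y) = min_{ω : x → y} max_{z ∈ ω} (𝒜(C) − a(z))`. -/
def commHeight {N C : ℕ} (E : Fin C → SimpleGraph (Fin N)) (x y : CState N C) : ℕ :=
  sInf {h : ℕ | ∃ ω, IsPath E x y ω ∧ pathHeight E ω = h}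

/-- The communication height `Δ(x,D)` between a state and a set of states. -/
def commHeightSet {N C : ℕ} (E : Fin C → SimpleGraph (Fin N)) (x : CState N C)
    (D : Set (CState N C)) : ℕ :=
  sInf {h : ℕ | ∃ ω y, y ∈ D ∧ IsPath E x y ω ∧ pathHeight E ω = h}

/-- `Γ(C)`: the worst communication height between a pair of dominant states. -/
def Gamma {N C : ℕ} (E : Fin C → SimpleGraph (Fin N)) : ℕ :=
  (DominantSet E).sup fun s => (DominantSet E).sup fun s' => commHeight E s s'

/-- The normalizing constant `Z(ν)` in the homogeneous case. -/
def Zhom {N C : ℕ} (E : Fin C → SimpleGraph (Fin N)) (ν : ℝ) : ℝ :=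
  ∑ y ∈ FeasibleSet E, ν ^ activeCount y

/-- The homogeneous stationary distribution `π_C(x) = ν^{a(x)} / Z(ν)`. -/
def piHom {N C : ℕ} (E : Fin C → SimpleGraph (Fin N)) (ν : ℝ) (x : CState N C) : ℝ :=
  ν ^ activeCount x / Zhom E ν


/-- The trap `S = { x ∈ 𝒳_C : Δ(s,x) < Γ(C) }` associated with a dominant state `s`. -/
def trapSet {N C : ℕ} (E : Fin C → SimpleGraph (Fin N)) (s : CState N C) :
    Finset (CState N C) :=
  (FeasibleSet E).filter fun x => commHeight E s x < Gamma E

/-- The homogeneous transition rates: `q(x,y) = ν` for an activation step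
(`y = x + c·e_i ∈ 𝒳_C`), `q(x,y) = 1` for a deactivation step (`y = x − c·e_i ∈ 𝒳_C`),
and `q(x,y) = 0` otherwise. -/
def qHom {N C : ℕ} (E : Fin C → SimpleGraph (Fin N)) (ν : ℝ) (x y : CState N C) : ℝ :=
  if Feasible E x ∧ Feasible E y ∧
      ∃ i : Fin N, (∀ j : Fin N, j ≠ i → y j = x j) ∧ x i = 0 ∧ y i ≠ 0 then ν
  else if Feasible E x ∧ Feasible E y ∧
      ∃ i : Fin N, (∀ j : Fin N, j ≠ i → y j = x j) ∧ x i ≠ 0 ∧ y i = 0 then 1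
  else 0

/-- The stationary probability flow out of the trap `S`:
`Q(S,Sᶜ) = Σ_{x ∈ S, y ∈ Sᶜ} π_C(x) q(x,y)` (with `Sᶜ = 𝒳_C \ S`). -/
def flowOut {N C : ℕ} (E : Fin C → SimpleGraph (Fin N)) (ν : ℝ) (s : CState N C) : ℝ :=
  ∑ x ∈ trapSet E s, ∑ y ∈ FeasibleSet E \ trapSet E s, piHom E ν x * qHom E ν x y

/-- `B(S)`: the number of pairs `(x,y) ∈ S × Sᶜ` such that `y` is one CSMA step from `x`;
it does not depend on `ν`. -/
def boundaryCount {N C : ℕ} (E : Fin C → SimpleGraph (Fin N)) (s : CState N C) : ℕ :=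
  ((trapSet E s ×ˢ (FeasibleSet E \ trapSet E s)).filter fun p => Step E p.1 p.2).card

theorem activeCount_of_deactivation {N C : ℕ} {x y : CState N C} {i : Fin N}
    (h : ∀ j : Fin N, j ≠ i → y j = x j) (hx : x i ≠ 0) (hy : y i = 0) :
    activeCount x = activeCount y + 1 := by
  have he : (Finset.univ.filter fun j => y j ≠ 0)
      = (Finset.univ.filter fun j => x j ≠ 0).erase i := by
    ext j
    by_cases hj : j = i
    · subst hj; simp [hy]
    · simp [hj, h j hj]
  have hi : i ∈ Finset.univ.filter fun j => x j ≠ 0 := by simp [hx]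
  unfold activeCount
  rw [he, Finset.card_erase_add_one hi]

theorem activeCount_le_maxActive {N C : ℕ} {E : Fin C → SimpleGraph (Fin N)}
    {x : CState N C} (hx : Feasible E x) : activeCount x ≤ maxActive E :=
  Finset.le_sup (f := activeCount) (by simp [FeasibleSet, hx])

theorem Step.symm {N C : ℕ} {E : Fin C → SimpleGraph (Fin N)} {x y : CState N C}
    (h : Step E x y) : Step E y x := by
  obtain ⟨hx, hy, i, hi, h⟩ := h
  exact ⟨hy, hx, i, fun j hj => (hi j hj).symm, by tauto⟩

theorem reflTransGen_step_zero {N C : ℕ} {E : Fin C → SimpleGraph (Fin N)}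
    (n : ℕ) (x : CState N C) (hx : Feasible E x) (hn : activeCount x = n) :
    Relation.ReflTransGen (Step E) x 0 := by
  induction n generalizing x with
  | zero =>
    have h0 : x = 0 := by
      funext i
      simpa using Finset.filter_eq_empty_iff.mp (Finset.card_eq_zero.mp hn) (Finset.mem_univ i)
    exact h0 ▸ .refl
  | succ n ih =>
    obtain ⟨i, hi⟩ : (Finset.univ.filter fun i => x i ≠ 0).Nonempty := by
      exact Finset.card_pos.mp (by change 0 < activeCount x; omega)
    have hxi : x i ≠ 0 := by simpa using hi
    have hoff : ∀ j : Fin N, j ≠ i → Function.update x i 0 j = x j :=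
      fun j hj => Function.update_of_ne hj _ _
    have hzero : Function.update x i 0 i = 0 := Function.update_self _ _ _
    have hf : Feasible E (Function.update x i 0) := by
      have aux : ∀ (k : Fin N) (c : Fin C), Function.update x i 0 k = c.succ → x k = c.succ := by
        intro k c hk
        by_cases hki : k = i
        · subst hki
          exact absurd (hzero.symm.trans hk) (Fin.succ_ne_zero c).symm
        · rwa [hoff k hki] at hk
      exact fun c j k hjk h => hx c j k hjk ⟨aux j c h.1, aux k c h.2⟩
    have hcount := activeCount_of_deactivation hoff hxi hzero
    exact (ih _ hf (by omega)).head ⟨hx, hf, i, hoff, Or.inr ⟨hxi, hzero⟩⟩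

theorem IsPath.append_step {N C : ℕ} {E : Fin C → SimpleGraph (Fin N)}
    {s x y : CState N C} {ω : List (CState N C)} (hω : IsPath E s x ω) (h : Step E x y) :
    IsPath E s y (ω ++ [y]) := by
  obtain ⟨hhead, hlast, hfeas, hchain⟩ := hω
  refine ⟨by simp [hhead], by simp, ?_, ?_⟩
  · intro z hz
    rcases List.mem_append.mp hz with hz | hz
    · exact hfeas z hz
    · rw [List.mem_singleton.mp hz]
      exact h.2.1
  · refine List.IsChain.append hchain (List.isChain_singleton y) ?_
    intro a ha b hb
    simp_all

theorem exists_isPath {N C : ℕ} {E : Fin C → SimpleGraph (Fin N)} {x y : CState N C}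
    (hx : Feasible E x) (hy : Feasible E y) : ∃ ω, IsPath E x y ω := by
  have hxy : Relation.ReflTransGen (Step E) x y :=
    (reflTransGen_step_zero _ x hx rfl).trans
      (Relation.ReflTransGen.mono (fun _ _ => Step.symm)
        _ _ (reflTransGen_step_zero _ y hy rfl).swap)
  clear hy
  induction hxy with
  | refl => exact ⟨[x], by simp, by simp, by simpa using hx, List.isChain_singleton x⟩
  | tail _ h ih =>
    obtain ⟨ω, hω⟩ := ih
    exact ⟨_, hω.append_step h⟩

theorem le_pathHeight {N C : ℕ} (E : Fin C → SimpleGraph (Fin N)) {z : CState N C}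
    {ω : List (CState N C)} (hz : z ∈ ω) : maxActive E - activeCount z ≤ pathHeight E ω := by
  induction ω with
  | nil => simp at hz
  | cons w ω ih =>
    rcases List.mem_cons.mp hz with rfl | hz
    · exact le_max_left _ _
    · exact (ih hz).trans (le_max_right _ _)

theorem pathHeight_append_singleton {N C : ℕ} (E : Fin C → SimpleGraph (Fin N))
    (ω : List (CState N C)) (y : CState N C) :
    pathHeight E (ω ++ [y]) = max (pathHeight E ω) (maxActive E - activeCount y) := by
  induction ω with
  | nil => simp [pathHeight]
  | cons w ω ih =>
    change max _ (pathHeight E (ω ++ [y])) = max (max _ (pathHeight E ω)) _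
    rw [ih, max_assoc]

theorem exists_isPath_pathHeight_eq {N C : ℕ} {E : Fin C → SimpleGraph (Fin N)}
    {x y : CState N C} (hx : Feasible E x) (hy : Feasible E y) :
    ∃ ω, IsPath E x y ω ∧ pathHeight E ω = commHeight E x y := by
  obtain ⟨ω, hω⟩ := exists_isPath hx hy
  exact Nat.sInf_mem (s := {h : ℕ | ∃ ω, IsPath E x y ω ∧ pathHeight E ω = h})
    ⟨_, ω, hω, rfl⟩

theorem le_commHeight {N C : ℕ} {E : Fin C → SimpleGraph (Fin N)} {s x : CState N C}
    (hs : Feasible E s) (hx : Feasible E x) :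
    maxActive E - activeCount x ≤ commHeight E s x := by
  obtain ⟨ω, hω, hh⟩ := exists_isPath_pathHeight_eq hs hx
  exact hh ▸ le_pathHeight E (List.mem_of_getLast? hω.2.1)

theorem commHeight_le_of_step {N C : ℕ} {E : Fin C → SimpleGraph (Fin N)}
    {s x y : CState N C} (hs : Feasible E s) (h : Step E x y) :
    commHeight E s y ≤ max (commHeight E s x) (maxActive E - activeCount y) := by
  obtain ⟨ω, hω, hh⟩ := exists_isPath_pathHeight_eq hs h.1
  rw [← hh, ← pathHeight_append_singleton]
  exact Nat.sInf_le ⟨_, hω.append_step h, rfl⟩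

/-- A step leaving the trap is a deactivation, and it starts at the level
`𝒜(C) − Γ(C) + 1`. -/
theorem qHom_and_activeCount_of_step_out {N C : ℕ} {E : Fin C → SimpleGraph (Fin N)}
    {s x y : CState N C} (hs : Feasible E s) (hx : x ∈ trapSet E s)
    (hy : y ∈ FeasibleSet E \ trapSet E s) (h : Step E x y) (ν : ℝ) :
    qHom E ν x y = 1 ∧ activeCount x = maxActive E - Gamma E + 1 := by
  have hxΓ : commHeight E s x < Gamma E := (Finset.mem_filter.mp hx).2
  have hyΓ : Gamma E ≤ commHeight E s y := by
    rw [Finset.mem_sdiff] at hy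
    by_contra hlt
    exact hy.2 (Finset.mem_filter.mpr ⟨hy.1, not_le.mp hlt⟩)
  have hlow := le_commHeight hs h.1
  have hup := commHeight_le_of_step hs h
  have hmax := activeCount_le_maxActive h.1
  obtain ⟨hfx, hfy, i, hi, hact | hdeact⟩ := h
  · have := activeCount_of_deactivation (fun j hj => (hi j hj).symm) hact.2 hact.1
    omega
  · have hcount := activeCount_of_deactivation hi hdeact.1 hdeact.2
    refine ⟨?_, by omega⟩
    unfold qHom
    rw [if_neg, if_pos ⟨hfx, hfy, i, hi, hdeact⟩]
    rintro ⟨-, -, k, hk, hxk, hyk⟩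
    have := activeCount_of_deactivation (fun j hj => (hk j hj).symm) hyk hxk
    omega

theorem qHom_eq_zero {N C : ℕ} {E : Fin C → SimpleGraph (Fin N)} {x y : CState N C}
    (h : ¬Step E x y) (ν : ℝ) : qHom E ν x y = 0 := by
  unfold qHom
  rw [if_neg, if_neg]
  · rintro ⟨hx, hy, i, hi, hd⟩
    exact h ⟨hx, hy, i, hi, Or.inr hd⟩
  · rintro ⟨hx, hy, i, hi, ha⟩
    exact h ⟨hx, hy, i, hi, Or.inl ha⟩

/-- Let `s, s' ∈ 𝒟_C` with `Δ(s,s') = Γ(C)` and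
`S = { x ∈ 𝒳_C : Δ(s,x) < Γ(C) }`. In the homogeneous case the stationary probability
flow out of `S` satisfies the exact identity
`Q(S,Sᶜ) = Z⁻¹ ν^{𝒜(C) − Γ(C) + 1} B(S)`, where `B(S)` is the (`ν`-independent) number
of pairs `(x,y) ∈ S × Sᶜ` one CSMA step apart. -/
theorem flowOut_identity (N C : ℕ) (hC : 1 ≤ C) (E : Fin C → SimpleGraph (Fin N))
    (hcard : 2 ≤ (DominantSet E).card)
    (s s' : CState N C) (hs : s ∈ DominantSet E) (hs' : s' ∈ DominantSet E)
    (hΓ : commHeight E s s' = Gamma E) (ν : ℝ) (hν : 1 < ν) :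
    flowOut E ν s =
      (Zhom E ν)⁻¹ * ν ^ (maxActive E - Gamma E + 1) * boundaryCount E s := by
  have hsf : Feasible E s := by
    have := (Finset.mem_filter.mp hs).1
    exact (Finset.mem_filter.mp this).2
  unfold flowOut boundaryCount
  rw [← Finset.sum_product', Finset.card_filter, Nat.cast_sum, Finset.mul_sum]
  refine Finset.sum_congr rfl fun p hp => ?_
  obtain ⟨hx, hy⟩ := Finset.mem_product.mp hp
  by_cases h : Step E p.1 p.2
  · obtain ⟨hq, ha⟩ := qHom_and_activeCount_of_step_out hsf hx hy h ν
    rw [hq, if_pos h, piHom, ha]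
    push_cast
    ring
  · simp [h, qHom_eq_zero h ν]

end CSMA
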